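/- Fix m > 0 and β > 0. The matter piece G_mat satisfies the Klein–Gordon equation: for every (t, x) ∈ ℝ × ℝ³, ∂²_t G_mat(t, x) − Δ_x G_mat(t, x) + m² G_mat(t, x) = 0, where Δ_x is the Laplacian in the spatial variables. (Equivalently, the temperature-dependent part of the thermal propagator is supported on the mass shell.) -/

import Mathlib

open MeasureTheory RealInnerProductSpace

/-- The matter piece of the finite-temperature free scalar two-point function. -/
noncomputable def Gmat (m β : ℝ) (t : ℝ) (x : EuclideanSpace ℝ (Fin 3)) : ℂ :=
  ∫ k : EuclideanSpace ℝ (Fin 3),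
    (((1 / (Real.exp (β * Real.sqrt (‖k‖ ^ 2 + m ^ 2)) - 1)) /
        (2 * Real.sqrt (‖k‖ ^ 2 + m ^ 2)) : ℝ) : ℂ) *
      Complex.exp (-Complex.I * ((Real.sqrt (‖k‖ ^ 2 + m ^ 2) * t - ⟪k, x⟫ : ℝ) : ℂ))

/-- Every fixed positive power is dominated by the exponential minus one. -/
lemma Real.pow_div_factorial_le_exp_sub_one {y : ℝ} (hy : 0 ≤ y) (n : ℕ) :
    y ^ (n + 1) / (n + 1).factorial ≤ Real.exp y - 1 := by
  have h := Real.sum_le_exp_of_nonneg hy (n + 2)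
  rw [Finset.sum_range_succ, Finset.sum_range_succ'] at h
  have h0 : 0 ≤ ∑ i ∈ Finset.range n, y ^ (i + 1) / ((i + 1).factorial : ℝ) :=
    Finset.sum_nonneg fun i _ => by positivity
  simp only [pow_zero, Nat.factorial_zero, Nat.cast_one, div_one] at h
  linarith

/-- Differentiation under the integral sign for a superposition of plane waves. -/
lemma hasDerivAt_integral_mul_cexp {α : Type*} [MeasurableSpace α] {μ : Measure α}
    {f : α → ℂ} {φ : α → ℝ} (hφ : Measurable φ) (hf : Integrable f μ)
    (hf' : Integrable (fun k => f k * φ k) μ) (s : ℝ) :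
    HasDerivAt (fun s : ℝ => ∫ k, f k * Complex.exp (Complex.I * φ k * s) ∂μ)
      (∫ k, Complex.I * (f k * φ k) * Complex.exp (Complex.I * φ k * s) ∂μ) s := by
  have hnorm (k : α) (u : ℝ) : ‖Complex.exp (Complex.I * φ k * u)‖ = 1 := by
    rw [mul_assoc, mul_comm, ← Complex.ofReal_mul, Complex.norm_exp_ofReal_mul_I]
  have hmeas (u : ℝ) :
      AEStronglyMeasurable (fun k => Complex.exp (Complex.I * φ k * u)) μ :=
    Measurable.aestronglyMeasurable (by fun_prop)
  refine (hasDerivAt_integral_of_dominated_loc_of_deriv_le (bound := fun k => ‖f k * φ k‖)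
    (F' := fun (u : ℝ) k => Complex.I * (f k * φ k) * Complex.exp (Complex.I * φ k * u))
    Filter.univ_mem ?_ ?_ ?_ ?_ hf'.norm ?_).2
  · exact .of_forall fun u => hf.1.mul (hmeas u)
  · exact hf.mono (hf.1.mul (hmeas s)) (.of_forall fun k => by rw [norm_mul, hnorm, mul_one])
  · exact (hf'.1.const_mul Complex.I).mul (hmeas s)
  · exact .of_forall fun k u _ => by rw [norm_mul, hnorm, norm_mul, Complex.norm_I]; simp
  · refine .of_forall fun k u _ => ?_
    have h := (((Complex.ofRealCLM.hasDerivAt (x := u)).const_mul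
      (Complex.I * φ k)).cexp).const_mul (f k)
    simp only [Complex.ofRealCLM_apply, Complex.ofReal_one, mul_one] at h
    exact h.congr_deriv (by ring)

/-- The second derivative of a superposition of plane waves. -/
lemma iteratedDeriv_two_integral_mul_cexp {α : Type*} [MeasurableSpace α] {μ : Measure α}
    {f : α → ℂ} {φ : α → ℝ} (hφ : Measurable φ) (hf : Integrable f μ)
    (hf' : Integrable (fun k => f k * φ k) μ) (hf'' : Integrable (fun k => f k * φ k ^ 2) μ)
    (s : ℝ) :
    iteratedDeriv 2 (fun s : ℝ => ∫ k, f k * Complex.exp (Complex.I * φ k * s) ∂μ) s =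
      ∫ k, -(f k * φ k ^ 2) * Complex.exp (Complex.I * φ k * s) ∂μ := by
  rw [iteratedDeriv_succ, iteratedDeriv_one,
    funext fun u => (hasDerivAt_integral_mul_cexp hφ hf hf' u).deriv]
  have h := hasDerivAt_integral_mul_cexp hφ (hf'.const_mul Complex.I)
    ((hf''.const_mul Complex.I).congr (.of_forall fun k => by ring)) s
  rw [h.deriv]
  congr 1 with k
  linear_combination (f k * φ k ^ 2 * Complex.exp (Complex.I * φ k * s)) * Complex.I_sq

section MassShell

variable {m β : ℝ}

lemma one_add_le_const_mul_energy (hm : 0 < m) (r : ℝ) :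
    1 + r ≤ (1 / m + 1) * Real.sqrt (r ^ 2 + m ^ 2) := by
  have h1 : m ≤ Real.sqrt (r ^ 2 + m ^ 2) := Real.le_sqrt_of_sq_le (by nlinarith)
  have h2 : r ≤ Real.sqrt (r ^ 2 + m ^ 2) := Real.le_sqrt_of_sq_le (by nlinarith)
  have h3 : 1 ≤ 1 / m * Real.sqrt (r ^ 2 + m ^ 2) := by
    rw [one_div_mul_eq_div, one_le_div hm]; exact h1
  linarith

lemma integrable_inv_energy_pow_four (hm : 0 < m) :
    Integrable fun k : EuclideanSpace ℝ (Fin 3) => (Real.sqrt (‖k‖ ^ 2 + m ^ 2) ^ 4)⁻¹ := by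
  have h := (integrable_one_add_norm (E := EuclideanSpace ℝ (Fin 3)) (μ := volume) (r := 4)
    (by simp; norm_num)).const_mul ((1 / m + 1) ^ 4)
  refine h.mono' (Measurable.aestronglyMeasurable (by fun_prop)) (.of_forall fun k => ?_)
  have hE : 0 < Real.sqrt (‖k‖ ^ 2 + m ^ 2) := Real.sqrt_pos.2 (by positivity)
  have hk : 0 < 1 + ‖k‖ := by positivity
  rw [Real.norm_of_nonneg (by positivity), Real.rpow_neg hk.le,
    show (4 : ℝ) = (4 : ℕ) by norm_num, Real.rpow_natCast, ← div_eq_mul_inv,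
    le_div_iff₀ (by positivity), inv_mul_le_iff₀ (by positivity), mul_comm, ← mul_pow]
  exact pow_le_pow_left₀ hk.le (one_add_le_const_mul_energy hm ‖k‖) 4

/-- All moments of the Bose–Einstein weight are integrable. -/
lemma integrable_boseEinstein_mul_energy_pow (hm : 0 < m) (hβ : 0 < β) (j : ℕ) :
    Integrable fun k : EuclideanSpace ℝ (Fin 3) =>
      (1 / (Real.exp (β * Real.sqrt (‖k‖ ^ 2 + m ^ 2)) - 1)) /
        (2 * Real.sqrt (‖k‖ ^ 2 + m ^ 2)) * Real.sqrt (‖k‖ ^ 2 + m ^ 2) ^ j := by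
  refine ((integrable_inv_energy_pow_four hm).const_mul
    ((j + 2 + 1).factorial / β ^ (j + 2 + 1) / 2)).mono'
    (Measurable.aestronglyMeasurable (by fun_prop)) (.of_forall fun k => ?_)
  have hE : 0 < Real.sqrt (‖k‖ ^ 2 + m ^ 2) := Real.sqrt_pos.2 (by positivity)
  generalize Real.sqrt (‖k‖ ^ 2 + m ^ 2) = E at hE
  have hexp := Real.pow_div_factorial_le_exp_sub_one (mul_pos hβ hE).le (j + 2)
  have hpos : 0 < (β * E) ^ (j + 2 + 1) / ((j + 2 + 1).factorial : ℝ) := by positivity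
  have hpos' := hpos.trans_le hexp
  rw [Real.norm_of_nonneg (by positivity)]
  calc 1 / (Real.exp (β * E) - 1) / (2 * E) * E ^ j
      ≤ 1 / ((β * E) ^ (j + 2 + 1) / ((j + 2 + 1).factorial : ℝ)) / (2 * E) * E ^ j := by
        gcongr
    _ = (j + 2 + 1).factorial / β ^ (j + 2 + 1) / 2 * (E ^ 4)⁻¹ := by
        field_simp
        ring

/-- Integrability of the Bose–Einstein weight times a symbol of polynomial order. -/
lemma integrable_boseEinstein_mul (hm : 0 < m) (hβ : 0 < β) (j : ℕ)
    {g : EuclideanSpace ℝ (Fin 3) → ℂ} (hg : Measurable g)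
    (hbound : ∀ k, ‖g k‖ ≤ Real.sqrt (‖k‖ ^ 2 + m ^ 2) ^ j) :
    Integrable fun k : EuclideanSpace ℝ (Fin 3) =>
      (((1 / (Real.exp (β * Real.sqrt (‖k‖ ^ 2 + m ^ 2)) - 1)) /
        (2 * Real.sqrt (‖k‖ ^ 2 + m ^ 2)) : ℝ) : ℂ) * g k := by
  refine (integrable_boseEinstein_mul_energy_pow hm hβ j).mono'
    (Measurable.aestronglyMeasurable (by fun_prop)) (.of_forall fun k => ?_)
  have hexp : 0 ≤ Real.exp (β * Real.sqrt (‖k‖ ^ 2 + m ^ 2)) - 1 :=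
    sub_nonneg.2 (Real.one_le_exp (by positivity))
  rw [norm_mul, Complex.norm_of_nonneg (by positivity)]
  exact mul_le_mul_of_nonneg_left (hbound k) (by positivity)

end MassShell

/-- For `m > 0`, `β > 0`, the matter piece satisfies the Klein–Gordon
equation `∂²_t G_mat − Δ_x G_mat + m² G_mat = 0` at every point of `ℝ × ℝ³`, where
the Laplacian is the sum of the second derivatives along the standard coordinate
directions of `ℝ³`. -/
theorem matter_piece_klein_gordon (m β : ℝ) (hm : 0 < m) (hβ : 0 < β) :
    ∀ (t : ℝ) (x : EuclideanSpace ℝ (Fin 3)),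
      iteratedDeriv 2 (fun s : ℝ => Gmat m β s x) t -
        (∑ i : Fin 3,
          iteratedDeriv 2 (fun s : ℝ => Gmat m β t (x + s • EuclideanSpace.single i (1 : ℝ))) 0) +
        (m : ℂ) ^ 2 * Gmat m β t x = 0 := by
  intro t x
  set w : EuclideanSpace ℝ (Fin 3) → ℂ := fun k =>
    (((1 / (Real.exp (β * Real.sqrt (‖k‖ ^ 2 + m ^ 2)) - 1)) /
        (2 * Real.sqrt (‖k‖ ^ 2 + m ^ 2)) : ℝ) : ℂ) with hw
  set E : EuclideanSpace ℝ (Fin 3) → ℝ := fun k => Real.sqrt (‖k‖ ^ 2 + m ^ 2) with hE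
  set e : EuclideanSpace ℝ (Fin 3) → ℂ := fun k =>
    Complex.exp (-Complex.I * ((E k * t - ⟪k, x⟫ : ℝ) : ℂ)) with he
  have hEm : Measurable E := by fun_prop
  have hem : Measurable e := by fun_prop
  have hnorm (r : ℝ) : ‖Complex.exp (Complex.I * r)‖ = 1 := by
    rw [mul_comm, Complex.norm_exp_ofReal_mul_I]
  have hen (k) : ‖e k‖ = 1 := by
    rw [he]
    simp only [neg_mul, ← mul_neg, ← Complex.ofReal_neg]
    exact hnorm _
  have hint (j : ℕ) {g : EuclideanSpace ℝ (Fin 3) → ℂ} (hg : Measurable g)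
      (hb : ∀ k, ‖g k‖ ≤ E k ^ j) : Integrable fun k => w k * g k :=
    integrable_boseEinstein_mul hm hβ j hg hb
  have hwave {p : EuclideanSpace ℝ (Fin 3) → ℂ} {φ : EuclideanSpace ℝ (Fin 3) → ℝ}
      (hp : Measurable p) (hpn : ∀ k, ‖p k‖ = 1) (hφ : Measurable φ)
      (hb : ∀ k, |φ k| ≤ E k) (s : ℝ) :
      iteratedDeriv 2 (fun s : ℝ => ∫ k, w k * p k * Complex.exp (Complex.I * φ k * s)) s =
        ∫ k, -(w k * p k * φ k ^ 2) * Complex.exp (Complex.I * φ k * s) := by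
    refine iteratedDeriv_two_integral_mul_cexp hφ
      (hint 0 hp fun k => by simp [hpn]) ?_ ?_ s
    · simp only [mul_assoc]
      exact hint 1 (by fun_prop) fun k => by simpa [hpn] using hb k
    · simp only [mul_assoc]
      refine hint 2 (by fun_prop) fun k => ?_
      simpa [hpn] using pow_le_pow_left₀ (abs_nonneg _) (hb k) 2
  have htime : iteratedDeriv 2 (fun s : ℝ => Gmat m β s x) t =
      ∫ k, -(w k * (e k * E k ^ 2)) := by
    have h := hwave (p := fun k => Complex.exp (Complex.I * (⟪k, x⟫ : ℝ))) (φ := fun k => -E k)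
      (by fun_prop) (fun k => hnorm _) (by fun_prop)
      (fun k => by rw [abs_neg, abs_of_nonneg (Real.sqrt_nonneg _)]) t
    convert h using 2
    · funext s
      refine integral_congr_ae (.of_forall fun k => ?_)
      simp only [hw, hE, mul_assoc, ← Complex.exp_add]
      push_cast
      ring_nf
    · funext k
      have : e k = Complex.exp (Complex.I * (⟪k, x⟫ : ℝ)) *
          Complex.exp (Complex.I * ((-E k : ℝ) : ℂ) * t) := by
        rw [he, ← Complex.exp_add]
        push_cast
        ring_nf
      rw [this]
      push_cast
      ring
  have hcoord (k : EuclideanSpace ℝ (Fin 3)) (i : Fin 3) : |k i| ≤ E k := by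
    refine (PiLp.norm_apply_le k i).trans (Real.le_sqrt_of_sq_le ?_)
    nlinarith [sq_nonneg m]
  have hspace (i : Fin 3) : iteratedDeriv 2
      (fun s : ℝ => Gmat m β t (x + s • EuclideanSpace.single i (1 : ℝ))) 0 =
      ∫ k, -(w k * (e k * ((k i : ℝ) : ℂ) ^ 2)) := by
    have h := hwave (p := e) (φ := fun k => k i) hem hen (by fun_prop) (fun k => hcoord k i) 0
    convert h using 2
    · funext s
      refine integral_congr_ae (.of_forall fun k => ?_)
      simp only [hw, he, hE, mul_assoc, ← Complex.exp_add, inner_add_right, inner_smul_right,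
        EuclideanSpace.inner_single_right]
      simp only [one_mul, conj_trivial]
      push_cast
      ring_nf
    · funext k
      simp
      ring
  have hG : Gmat m β t x = ∫ k, w k * e k := rfl
  have hi0 : Integrable fun k => w k * e k := hint 0 hem fun k => by simp [hen]
  have hi1 : Integrable fun k => -(w k * (e k * E k ^ 2)) :=
    (hint 2 (by fun_prop) fun k => by simp [hen]).neg
  have hi2 (i : Fin 3) : Integrable fun k => -(w k * (e k * ((k i : ℝ) : ℂ) ^ 2)) := by
    refine (hint 2 (by fun_prop) fun k => ?_).neg
    simpa [hen] using pow_le_pow_left₀ (abs_nonneg _) (hcoord k i) 2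
  have hi3 : Integrable fun k => ∑ i : Fin 3, -(w k * (e k * ((k i : ℝ) : ℂ) ^ 2)) :=
    integrable_finsetSum _ fun i _ => hi2 i
  rw [htime, hG, Finset.sum_congr rfl fun i _ => hspace i,
    ← integral_finsetSum _ fun i _ => hi2 i, ← integral_const_mul,
    ← integral_sub hi1 hi3, ← integral_add (by exact hi1.sub hi3) (hi0.const_mul _)]
  refine integral_eq_zero_of_ae (.of_forall fun k => ?_)
  have hshell : ((E k : ℝ) : ℂ) ^ 2 = (∑ i, ((k i : ℝ) : ℂ) ^ 2) + (m : ℂ) ^ 2 := by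
    have : E k ^ 2 = (∑ i, k i ^ 2) + m ^ 2 := by
      rw [hE, Real.sq_sqrt (by positivity), EuclideanSpace.real_norm_sq_eq]
    exact_mod_cast this
  simp only [Finset.sum_neg_distrib, ← Finset.mul_sum, Pi.zero_apply, hshell]
  ring
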